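/- Fix an integer r ≥ 1 and p ∈ (0,1). The average position of the r-th strict left-to-right maximum in a random word of length n with i.i.d. geometric(p) letters — that is, the conditional expectation of the position τ_r of the r-th strict left-to-right maximum given that the word has at least r strict left-to-right maxima — equals (1/(r−1)!) · ( (p/q) · log_Q n )^{r−1} + O( (log n)^{r−2} ) as n → ∞: there exist constants C > 0 and N such that the conditional expectation differs from (1/(r−1)!) ( (p/q) log_Q n )^{r−1} by at most C (log n)^{r−2} for all n ≥ N. Here log_Q n = (log n)/(log Q). -/

import Mathlib

open scoped BigOperators

/-- Geometric(p) weight of a letter `k ∈ ℕ`: `P(X = k) = p (1-p)^(k-1)` for `k ≥ 1`,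
and `0` otherwise (letters take values in `{1, 2, 3, …}`). -/
noncomputable def geomWt (p : ℝ) (k : ℕ) : ℝ := if 1 ≤ k then p * (1 - p) ^ (k - 1) else 0

/-- Probability of the word `w` of length `n` under i.i.d. geometric(p) letters. -/
noncomputable def wordWt (p : ℝ) {n : ℕ} (w : Fin n → ℕ) : ℝ := ∏ j, geomWt p (w j)

/-- The set of (positions of) strict left-to-right maxima of the word `w`:
indices `j` with `w i < w j` for all `i < j`. -/
def strictLTRMaxSet {n : ℕ} (w : Fin n → ℕ) : Finset (Fin n) :=
  Finset.univ.filter (fun j => ∀ i, i < j → w i < w j)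

/-- The (1-based) position `τ_r` of the `r`-th strict left-to-right maximum of `w`
(junk value `0` if there are fewer than `r` of them). -/
def strictLTRMaxPos {n : ℕ} (w : Fin n → ℕ) (r : ℕ) : ℕ :=
  (((strictLTRMaxSet w).sort (· ≤ ·)).map (fun j => (j : ℕ) + 1)).getD (r - 1) 0

/-- The value `a_{τ_r}` of the `r`-th strict left-to-right maximum of `w`
(junk value `0` if there are fewer than `r` of them). -/
def strictLTRMaxVal {n : ℕ} (w : Fin n → ℕ) (r : ℕ) : ℕ :=
  (((strictLTRMaxSet w).sort (· ≤ ·)).map w).getD (r - 1) 0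

/-- The expectation of `g` over random words of length `n` with geometric(p) letters. -/
noncomputable def wordExp (p : ℝ) (n : ℕ) (g : (Fin n → ℕ) → ℝ) : ℝ := ∑' w, g w * wordWt p w

section Expectation

variable {p : ℝ}

lemma geomWt_nonneg (hp0 : 0 < p) (hp1 : p < 1) (k : ℕ) : 0 ≤ geomWt p k := by
  unfold geomWt
  have : 0 ≤ 1 - p := by linarith
  split_ifs <;> positivity

lemma geomWt_zero : geomWt p 0 = 0 := by simp [geomWt]

lemma geomWt_succ (k : ℕ) : geomWt p (k + 1) = p * (1 - p) ^ k := by simp [geomWt]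

lemma hasSum_geomWt_tail (hp0 : 0 < p) (hp1 : p < 1) (K : ℕ) :
    HasSum (fun x => (if K < x then 1 else 0) * geomWt p x) ((1 - p) ^ K) := by
  set F : ℕ → ℝ := fun x => (if K < x then 1 else 0) * geomWt p x with hF
  have h : HasSum (fun x => (1 - p) ^ K * (p * (1 - p) ^ x)) ((1 - p) ^ K * (p * (1 - (1 - p))⁻¹)) :=
    ((hasSum_geometric_of_lt_one (by linarith) (by linarith)).mul_left p).mul_left _
  have hval : (1 - p) ^ K * (p * (1 - (1 - p))⁻¹) = (1 - p) ^ K := by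
    rw [sub_sub_cancel, mul_inv_cancel₀ hp0.ne', mul_one]
  have hfun : (fun x => (1 - p) ^ K * (p * (1 - p) ^ x)) = fun x => F (x + (K + 1)) := by
    funext x
    rw [hF]
    dsimp only
    rw [if_pos (by omega), ← add_assoc, geomWt_succ, pow_add]
    ring
  rw [hval, hfun] at h
  have h2 := (hasSum_nat_add_iff (K + 1)).1 h
  rwa [Finset.sum_eq_zero, add_zero] at h2
  intro x hx
  rw [hF]
  dsimp only
  rw [if_neg (by simp at hx; omega), zero_mul]

lemma hasSum_geomWt (hp0 : 0 < p) (hp1 : p < 1) : HasSum (geomWt p) 1 := by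
  have h := hasSum_geomWt_tail hp0 hp1 0
  have hfun : (fun x => (if 0 < x then 1 else 0) * geomWt p x) = geomWt p := by
    funext x
    rcases x with _ | x <;> simp [geomWt]
  rwa [hfun, pow_zero] at h

lemma hasSum_geomWt_le (hp0 : 0 < p) (hp1 : p < 1) (K : ℕ) :
    HasSum (fun x => (if x ≤ K then 1 else 0) * geomWt p x) (1 - (1 - p) ^ K) := by
  refine ((hasSum_geomWt hp0 hp1).sub (hasSum_geomWt_tail hp0 hp1 K)).congr_fun ?_
  intro x
  by_cases h : x ≤ K
  · simp [h, not_lt.2 h]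
  · simp [h, not_le.1 h]

lemma wordWt_nonneg (hp0 : 0 < p) (hp1 : p < 1) {n : ℕ} (w : Fin n → ℕ) : 0 ≤ wordWt p w :=
  Finset.prod_nonneg fun _ _ => geomWt_nonneg hp0 hp1 _

lemma wordWt_eq_init_mul_last {n : ℕ} (w : Fin (n + 1) → ℕ) :
    wordWt p w = wordWt p (Fin.init w) * geomWt p (w (Fin.last n)) := by
  simp [wordWt, Fin.prod_univ_castSucc, Fin.init]

lemma wordWt_eq_zero {n : ℕ} {w : Fin n → ℕ} {i : Fin n} (h : w i = 0) : wordWt p w = 0 :=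
  Finset.prod_eq_zero (Finset.mem_univ i) (by rw [h, geomWt_zero])

/-- Splitting a word into its last letter and the preceding ones. -/
def wordSplit (n : ℕ) : (Fin (n + 1) → ℕ) ≃ (Fin n → ℕ) × ℕ :=
  (Fin.snocEquiv fun _ => ℕ).symm.trans (Equiv.prodComm _ _)

lemma wordSplit_apply {n : ℕ} (w : Fin (n + 1) → ℕ) :
    wordSplit n w = (Fin.init w, w (Fin.last n)) := rfl

lemma summable_wordWt (hp0 : 0 < p) (hp1 : p < 1) (n : ℕ) :
    Summable (wordWt p : (Fin n → ℕ) → ℝ) := by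
  induction n with
  | zero => exact (hasSum_fintype _).summable
  | succ n ih =>
    have h := ih.mul_of_nonneg (hasSum_geomWt hp0 hp1).summable
      (fun w => wordWt_nonneg hp0 hp1 w) (fun k => geomWt_nonneg hp0 hp1 k)
    convert (wordSplit n).summable_iff.2 h using 1
    funext w
    simp [wordWt_eq_init_mul_last, wordSplit_apply]

lemma summable_mul_wordWt (hp0 : 0 < p) (hp1 : p < 1) {n : ℕ} {g : (Fin n → ℕ) → ℝ} {B : ℝ}
    (hg : ∀ w, |g w| ≤ B) : Summable fun w => g w * wordWt p w := by
  refine Summable.of_norm_bounded ((summable_wordWt hp0 hp1 n).mul_left B) fun w => ?_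
  rw [norm_mul, Real.norm_eq_abs, Real.norm_eq_abs, abs_of_nonneg (wordWt_nonneg hp0 hp1 w)]
  exact mul_le_mul_of_nonneg_right (hg w) (wordWt_nonneg hp0 hp1 w)

lemma wordExp_congr {n : ℕ} {g g' : (Fin n → ℕ) → ℝ} (h : ∀ w, (∀ i, 0 < w i) → g w = g' w) :
    wordExp p n g = wordExp p n g' := by
  refine tsum_congr fun w => ?_
  by_cases hw : ∀ i, 0 < w i
  · rw [h w hw]
  · push Not at hw
    obtain ⟨i, hi⟩ := hw
    rw [wordWt_eq_zero (Nat.le_zero.1 hi), mul_zero, mul_zero]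

lemma wordExp_mono (hp0 : 0 < p) (hp1 : p < 1) {n : ℕ} {g g' : (Fin n → ℕ) → ℝ} {B B' : ℝ}
    (hg : ∀ w, |g w| ≤ B) (hg' : ∀ w, |g' w| ≤ B')
    (h : ∀ w, (∀ i, 0 < w i) → g w ≤ g' w) : wordExp p n g ≤ wordExp p n g' := by
  refine (summable_mul_wordWt hp0 hp1 hg).tsum_le_tsum (fun w => ?_)
    (summable_mul_wordWt hp0 hp1 hg')
  by_cases hw : ∀ i, 0 < w i
  · exact mul_le_mul_of_nonneg_right (h w hw) (wordWt_nonneg hp0 hp1 w)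
  · push Not at hw
    obtain ⟨i, hi⟩ := hw
    rw [wordWt_eq_zero (Nat.le_zero.1 hi), mul_zero, mul_zero]

lemma wordExp_nonneg (hp0 : 0 < p) (hp1 : p < 1) {n : ℕ} {g : (Fin n → ℕ) → ℝ}
    (hg : ∀ w, 0 ≤ g w) : 0 ≤ wordExp p n g :=
  tsum_nonneg fun w => mul_nonneg (hg w) (wordWt_nonneg hp0 hp1 w)

lemma wordExp_add (hp0 : 0 < p) (hp1 : p < 1) {n : ℕ} {g g' : (Fin n → ℕ) → ℝ} {B B' : ℝ}
    (hg : ∀ w, |g w| ≤ B) (hg' : ∀ w, |g' w| ≤ B') :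
    wordExp p n (fun w => g w + g' w) = wordExp p n g + wordExp p n g' := by
  unfold wordExp
  rw [← (summable_mul_wordWt hp0 hp1 hg).tsum_add (summable_mul_wordWt hp0 hp1 hg')]
  exact tsum_congr fun w => by ring

lemma wordExp_const_mul {n : ℕ} (c : ℝ) (g : (Fin n → ℕ) → ℝ) :
    wordExp p n (fun w => c * g w) = c * wordExp p n g := by
  unfold wordExp
  rw [← tsum_mul_left]
  exact tsum_congr fun w => by ring

lemma wordExp_sum (hp0 : 0 < p) (hp1 : p < 1) {n : ℕ} {ι : Type*} (s : Finset ι)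
    {g : ι → (Fin n → ℕ) → ℝ} {B : ℝ} (hg : ∀ i w, |g i w| ≤ B) :
    wordExp p n (fun w => ∑ i ∈ s, g i w) = ∑ i ∈ s, wordExp p n (g i) := by
  unfold wordExp
  rw [← Summable.tsum_finsetSum fun i _ => summable_mul_wordWt hp0 hp1 (hg i)]
  exact tsum_congr fun w => by rw [Finset.sum_mul]

lemma wordExp_init_mul_last (hp0 : 0 < p) (hp1 : p < 1) {n : ℕ} {g : (Fin n → ℕ) → ℝ}
    {h : ℕ → ℝ} {B a : ℝ} (hg : ∀ w, |g w| ≤ B)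
    (hh : HasSum (fun x => h x * geomWt p x) a) :
    wordExp p (n + 1) (fun w => g (Fin.init w) * h (w (Fin.last n))) = wordExp p n g * a := by
  unfold wordExp
  rw [← hh.tsum_eq, tsum_mul_tsum_of_summable_norm
    (summable_mul_wordWt hp0 hp1 hg).norm hh.summable.norm, ← (wordSplit n).tsum_eq]
  refine tsum_congr fun w => ?_
  rw [wordSplit_apply, wordWt_eq_init_mul_last]
  ring

lemma wordExp_init (hp0 : 0 < p) (hp1 : p < 1) {n : ℕ} {g : (Fin n → ℕ) → ℝ} {B : ℝ}
    (hg : ∀ w, |g w| ≤ B) :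
    wordExp p (n + 1) (fun w => g (Fin.init w)) = wordExp p n g := by
  have h := wordExp_init_mul_last hp0 hp1 (h := fun _ => 1) hg
    (by simpa using hasSum_geomWt hp0 hp1)
  simpa only [mul_one] using h

lemma wordExp_zero (g : (Fin 0 → ℕ) → ℝ) : wordExp p 0 g = g ![] := by
  unfold wordExp
  rw [tsum_fintype, Fintype.sum_unique]
  simp only [wordWt, Finset.univ_eq_empty, Finset.prod_empty, mul_one]
  exact congrArg g (Subsingleton.elim _ _)

lemma wordExp_one (hp0 : 0 < p) (hp1 : p < 1) (n : ℕ) : wordExp p n (fun _ => 1) = 1 := by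
  induction n with
  | zero => exact wordExp_zero _
  | succ n ih => exact (wordExp_init hp0 hp1 (g := fun _ => 1) (B := 1) (by simp)).trans ih

lemma abs_indicator_le_one (P : Prop) [Decidable P] : |if P then (1 : ℝ) else 0| ≤ 1 := by
  split_ifs <;> simp

end Expectation

section Records

variable {n : ℕ}

lemma strictLTRMaxSet_succ (w : Fin (n + 1) → ℕ) :
    strictLTRMaxSet w = (strictLTRMaxSet (Fin.init w)).map Fin.castSuccEmb ∪
      if ∀ i, Fin.init w i < w (Fin.last n) then {Fin.last n} else ∅ := by
  ext j
  refine Fin.lastCases ?_ (fun j => ?_) j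
  · by_cases h : ∀ i, Fin.init w i < w (Fin.last n)
    · simp only [strictLTRMaxSet, Finset.mem_filter, Finset.mem_univ, true_and, if_pos h,
        Finset.mem_union, Finset.mem_singleton, or_true, iff_true]
      intro i hi
      have := h (i.castPred hi.ne)
      simpa [Fin.init] using this
    · simp only [strictLTRMaxSet, Finset.mem_filter, Finset.mem_univ, true_and, if_neg h,
        Finset.union_empty, Finset.mem_map, Fin.castSuccEmb_apply]
      constructor
      · intro h'
        exact absurd (fun i => h' i.castSucc (Fin.castSucc_lt_last i)) h
      · rintro ⟨a, -, ha⟩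
        exact absurd ha (Fin.castSucc_lt_last a).ne
  · have h0 : j.castSucc ∉ (if ∀ i, Fin.init w i < w (Fin.last n) then
        ({Fin.last n} : Finset (Fin (n + 1))) else ∅) := by
      split_ifs <;> simp [(Fin.castSucc_lt_last j).ne]
    simp only [Finset.mem_union, h0, or_false, Finset.mem_map, Fin.castSuccEmb_apply,
      Fin.castSucc_inj, exists_eq_right, strictLTRMaxSet, Finset.mem_filter, Finset.mem_univ,
      true_and]
    constructor
    · intro h i hi
      exact h i.castSucc (by simpa using hi)
    · intro h i hi
      have hne : i ≠ Fin.last n := (hi.trans (Fin.castSucc_lt_last j)).ne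
      have := h (i.castPred hne) (by simpa [Fin.lt_def] using hi)
      simpa [Fin.init] using this

lemma sort_strictLTRMaxSet_succ (w : Fin (n + 1) → ℕ) :
    (strictLTRMaxSet w).sort (· ≤ ·) =
      ((strictLTRMaxSet (Fin.init w)).sort (· ≤ ·)).map Fin.castSucc ++
        if ∀ i, Fin.init w i < w (Fin.last n) then [Fin.last n] else [] := by
  set l := ((strictLTRMaxSet (Fin.init w)).sort (· ≤ ·)).map Fin.castSucc ++
        if ∀ i, Fin.init w i < w (Fin.last n) then [Fin.last n] else [] with hl
  have hset : strictLTRMaxSet w = l.toFinset := by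
    rw [strictLTRMaxSet_succ, hl]
    ext j
    split_ifs <;> simp
  have hs : l.Pairwise (· < ·) := by
    rw [hl, List.pairwise_append]
    refine ⟨?_, ?_, ?_⟩
    · rw [List.pairwise_map]
      simpa using (Finset.sortedLT_sort (strictLTRMaxSet (Fin.init w))).pairwise
    · split_ifs <;> simp
    · intro a ha b hb
      obtain ⟨c, -, rfl⟩ := List.mem_map.1 ha
      split_ifs at hb
      · rw [List.mem_singleton.1 hb]
        exact Fin.castSucc_lt_last c
      · simp at hb
  rw [hset]
  exact (List.toFinset_sort (· ≤ ·) (hs.imp ne_of_lt)).2 (hs.imp le_of_lt)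

lemma card_strictLTRMaxSet_succ (w : Fin (n + 1) → ℕ) :
    (strictLTRMaxSet w).card = (strictLTRMaxSet (Fin.init w)).card +
      if ∀ i, Fin.init w i < w (Fin.last n) then 1 else 0 := by
  rw [← Finset.length_sort (· ≤ ·), sort_strictLTRMaxSet_succ]
  split_ifs <;> simp

lemma strictLTRMaxPos_eq (w : Fin n → ℕ) (r : ℕ) :
    strictLTRMaxPos w r =
      (((strictLTRMaxSet w).sort (· ≤ ·)).map fun j => (j.val + 1 : ℕ)).getD (r - 1) 0 := by
  simp [strictLTRMaxPos, List.map_eq_flatMap, List.flatMap_assoc]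

/-- The position of the `r`-th record, as a real number, replaced by `0` when it is missing. -/
noncomputable def truncPos (r : ℕ) (w : Fin n → ℕ) : ℝ :=
  if r ≤ (strictLTRMaxSet w).card then (strictLTRMaxPos w r : ℝ) else 0

lemma truncPos_succ {r : ℕ} (hr : 1 ≤ r) (w : Fin (n + 1) → ℕ) :
    truncPos r w = truncPos r (Fin.init w) + (n + 1 : ℝ) *
      ((if (strictLTRMaxSet (Fin.init w)).card < r then 1 else 0) -
        if (strictLTRMaxSet w).card < r then 1 else 0) := by
  have hc := card_strictLTRMaxSet_succ w
  have hlen := Finset.length_sort (s := strictLTRMaxSet (Fin.init w)) (· ≤ ·)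
  unfold truncPos
  rw [strictLTRMaxPos_eq, strictLTRMaxPos_eq]
  rw [sort_strictLTRMaxSet_succ]
  by_cases h : ∀ i, Fin.init w i < w (Fin.last n)
  · rw [if_pos h] at hc
    rw [if_pos h, List.map_append, List.map_map]
    rcases lt_trichotomy (strictLTRMaxSet (Fin.init w)).card (r - 1) with h1 | h1 | h1
    · rw [if_neg (by omega), if_neg (by omega), if_pos (by omega), if_pos (by omega)]
      simp
    · rw [if_pos (by omega), if_neg (by omega), if_pos (by omega), if_neg (by omega),
        List.getD_append_right _ _ _ _ (by simp; omega)]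
      simp [h1]
    · rw [if_pos (by omega), if_pos (by omega), if_neg (by omega), if_neg (by omega),
        List.getD_append _ _ _ _ (by simp; omega)]
      simp [Function.comp_def]
  · rw [if_neg h, add_zero] at hc
    rw [if_neg h, hc, List.append_nil, List.map_map]
    simp [Function.comp_def]

lemma truncPos_bounded {r : ℕ} (hr : 1 ≤ r) (n : ℕ) :
    ∃ B : ℝ, ∀ w : Fin n → ℕ, |truncPos r w| ≤ B := by
  induction n with
  | zero =>
    exact ⟨|truncPos r (![] : Fin 0 → ℕ)|, fun w => by rw [Subsingleton.elim w ![]]⟩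
  | succ n ih =>
    obtain ⟨B, hB⟩ := ih
    refine ⟨B + (n + 1), fun w => ?_⟩
    rw [truncPos_succ hr]
    refine (abs_add_le _ _).trans (add_le_add (hB _) ?_)
    rw [abs_mul, abs_of_nonneg (by positivity : (0 : ℝ) ≤ n + 1)]
    refine mul_le_of_le_one_right (by positivity) ?_
    split_ifs <;> simp

lemma record_iff_sup_lt {w : Fin (n + 1) → ℕ} (hw : 0 < w (Fin.last n)) :
    (∀ i, Fin.init w i < w (Fin.last n)) ↔ Finset.univ.sup (Fin.init w) < w (Fin.last n) := by
  rw [Finset.sup_lt_iff (by simpa using hw)]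
  simp

lemma sup_word_succ (w : Fin (n + 1) → ℕ) :
    Finset.univ.sup w = max (Finset.univ.sup (Fin.init w)) (w (Fin.last n)) := by
  rw [Fin.univ_castSuccEmb, Finset.sup_cons, Finset.sup_map, sup_comm]
  rfl

end Records

/-- The probability that a random word of length `n` has exactly `s` records. -/
noncomputable def recordProb (p : ℝ) (n s : ℕ) : ℝ :=
  wordExp p n fun w => if (strictLTRMaxSet w).card = s then 1 else 0

/-- The probability that a random word of length `n` has exactly `s` records and maximum `k`. -/
noncomputable def recordMaxProb (p : ℝ) (n s k : ℕ) : ℝ :=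
  wordExp p n fun w => if (strictLTRMaxSet w).card = s ∧ Finset.univ.sup w = k then 1 else 0

/-- The probability that a random word of length `n` has exactly `s` records and its maximum
exceeds `K`. -/
noncomputable def recordTailProb (p : ℝ) (n s K : ℕ) : ℝ :=
  wordExp p n fun w => if (strictLTRMaxSet w).card = s ∧ K < Finset.univ.sup w then 1 else 0

section Recursion

variable {p : ℝ}

lemma recordProb_nonneg (hp0 : 0 < p) (hp1 : p < 1) (n s : ℕ) : 0 ≤ recordProb p n s :=
  wordExp_nonneg hp0 hp1 fun _ => by split_ifs <;> simp

lemma recordMaxProb_nonneg (hp0 : 0 < p) (hp1 : p < 1) (n s k : ℕ) : 0 ≤ recordMaxProb p n s k :=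
  wordExp_nonneg hp0 hp1 fun _ => by split_ifs <;> simp

lemma recordTailProb_nonneg (hp0 : 0 < p) (hp1 : p < 1) (n s K : ℕ) :
    0 ≤ recordTailProb p n s K :=
  wordExp_nonneg hp0 hp1 fun _ => by split_ifs <;> simp

lemma recordMaxProb_zero_left (s k : ℕ) :
    recordMaxProb p 0 s k = if s = 0 ∧ k = 0 then 1 else 0 := by
  rw [recordMaxProb, wordExp_zero]
  simp [strictLTRMaxSet, eq_comm]

lemma recordTailProb_zero_left (s K : ℕ) : recordTailProb p 0 s K = 0 := by
  rw [recordTailProb, wordExp_zero]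
  simp

lemma recordProb_zero_zero : recordProb p 0 0 = 1 := by
  rw [recordProb, wordExp_zero]
  simp [strictLTRMaxSet]

lemma card_strictLTRMaxSet_pos {n : ℕ} (w : Fin (n + 1) → ℕ) : 0 < (strictLTRMaxSet w).card :=
  Finset.card_pos.2 ⟨0, by simp [strictLTRMaxSet]⟩

lemma recordProb_succ_zero (n : ℕ) : recordProb p (n + 1) 0 = 0 := by
  unfold recordProb wordExp
  simp only [(card_strictLTRMaxSet_pos _).ne', if_false, zero_mul, tsum_zero]

lemma recordMaxProb_succ_zero (n k : ℕ) : recordMaxProb p (n + 1) 0 k = 0 := by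
  unfold recordMaxProb wordExp
  simp only [(card_strictLTRMaxSet_pos _).ne', false_and, if_false, zero_mul, tsum_zero]

lemma card_strictLTRMaxSet_succ_of_pos {n : ℕ} {w : Fin (n + 1) → ℕ} (hw : ∀ i, 0 < w i) :
    (strictLTRMaxSet w).card = (strictLTRMaxSet (Fin.init w)).card +
      if Finset.univ.sup (Fin.init w) < w (Fin.last n) then 1 else 0 := by
  rw [card_strictLTRMaxSet_succ]
  simp only [record_iff_sup_lt (hw _)]

lemma recordMaxProb_succ_succ (hp0 : 0 < p) (hp1 : p < 1) (n s k : ℕ) :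
    recordMaxProb p (n + 1) (s + 1) k = (1 - (1 - p) ^ k) * recordMaxProb p n (s + 1) k +
      p / (1 - p) * (1 - p) ^ k * ∑ i ∈ Finset.range k, recordMaxProb p n s i := by
  have hq : 1 - p ≠ 0 := by linarith
  set g : (Fin n → ℕ) → ℝ := fun w =>
    if (strictLTRMaxSet w).card = s + 1 ∧ Finset.univ.sup w = k then 1 else 0
  set g' : (Fin n → ℕ) → ℝ := fun w =>
    if (strictLTRMaxSet w).card = s ∧ Finset.univ.sup w < k then 1 else 0
  have hsum : wordExp p n g' = ∑ i ∈ Finset.range k, recordMaxProb p n s i := by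
    unfold recordMaxProb
    rw [← wordExp_sum hp0 hp1 _ fun i w => abs_indicator_le_one _]
    congr 1
    funext w
    simp [g', ite_and]
  have hgeom : HasSum (fun x => (if x = k then 1 else 0) * geomWt p x) (geomWt p k) := by
    refine (hasSum_ite_eq k (geomWt p k)).congr_fun fun x => ?_
    split_ifs with h <;> simp [h]
  have hg : ∀ w, |g w| ≤ 1 := fun w => abs_indicator_le_one _
  have hg' : ∀ w, |g' w| ≤ 1 := fun w => abs_indicator_le_one _
  have hbound : ∀ {a b : ℝ}, |a| ≤ 1 → |b| ≤ 1 → |a * b| ≤ 1 := fun ha hb => by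
    rw [abs_mul]
    exact mul_le_one₀ ha (abs_nonneg _) hb
  have hsplit : recordMaxProb p (n + 1) (s + 1) k =
      wordExp p (n + 1) (fun w => g (Fin.init w) * (if w (Fin.last n) ≤ k then 1 else 0) +
        g' (Fin.init w) * (if w (Fin.last n) = k then 1 else 0)) := by
    refine wordExp_congr fun w hw => ?_
    rw [card_strictLTRMaxSet_succ_of_pos hw, sup_word_succ]
    simp only [g, g', ite_zero_mul_ite_zero, mul_one]
    by_cases h : Finset.univ.sup (Fin.init w) < w (Fin.last n)
    · have h1 : ¬(((strictLTRMaxSet (Fin.init w)).card = s + 1 ∧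
          Finset.univ.sup (Fin.init w) = k) ∧ w (Fin.last n) ≤ k) := by omega
      rw [if_pos h, max_eq_right h.le, if_neg h1, zero_add]
      refine if_congr ?_ rfl rfl
      omega
    · have h1 : ¬(((strictLTRMaxSet (Fin.init w)).card = s ∧
          Finset.univ.sup (Fin.init w) < k) ∧ w (Fin.last n) = k) := by omega
      rw [if_neg h, max_eq_left (not_lt.1 h), if_neg h1, add_zero, add_zero]
      refine if_congr ?_ rfl rfl
      omega
  rw [hsplit, wordExp_add hp0 hp1 (B := 1) (B' := 1)
      (fun w => hbound (hg (Fin.init w)) (abs_indicator_le_one (w (Fin.last n) ≤ k)))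
      (fun w => hbound (hg' (Fin.init w)) (abs_indicator_le_one (w (Fin.last n) = k))),
    wordExp_init_mul_last hp0 hp1 (h := fun x : ℕ => if x ≤ k then (1 : ℝ) else 0) hg
      (hasSum_geomWt_le hp0 hp1 k),
    wordExp_init_mul_last hp0 hp1 (h := fun x : ℕ => if x = k then (1 : ℝ) else 0) hg' hgeom, hsum]
  rcases k with _ | k
  · simp
  · rw [geomWt_succ, pow_succ]
    change recordMaxProb p n (s + 1) (k + 1) * _ + _ = _
    field_simp

lemma recordProb_eq_sum_add_tail (hp0 : 0 < p) (hp1 : p < 1) (n s K : ℕ) :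
    recordProb p n s =
      ∑ k ∈ Finset.range (K + 1), recordMaxProb p n s k + recordTailProb p n s K := by
  unfold recordMaxProb recordTailProb
  rw [← wordExp_sum hp0 hp1 _ fun i w => abs_indicator_le_one _,
    ← wordExp_add hp0 hp1 (B := 1) (B' := 1) _ fun w => abs_indicator_le_one _]
  · unfold recordProb
    congr 1
    funext w
    generalize Finset.univ.sup w = m
    by_cases h : (strictLTRMaxSet w).card = s <;>
      by_cases h2 : m ≤ K <;> simp [h, h2]
  · intro w
    by_cases h : (strictLTRMaxSet w).card = s <;> simp [h]
    split_ifs <;> simp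

lemma recordTailProb_succ_le (hp0 : 0 < p) (hp1 : p < 1) (n s K : ℕ) :
    recordTailProb p (n + 1) (s + 1) K ≤
      recordTailProb p n (s + 1) K + recordProb p n s * (1 - p) ^ K := by
  have hb : ∀ w : Fin (n + 1) → ℕ, |(if (strictLTRMaxSet (Fin.init w)).card = s then (1 : ℝ) else 0) *
      (if K < w (Fin.last n) then 1 else 0)| ≤ 1 := fun w => by
    rw [abs_mul]
    exact mul_le_one₀ (abs_indicator_le_one _) (abs_nonneg _) (abs_indicator_le_one _)
  unfold recordProb recordTailProb
  rw [← wordExp_init_mul_last hp0 hp1 (h := fun x => if K < x then 1 else 0)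
      (fun w => abs_indicator_le_one _) (hasSum_geomWt_tail hp0 hp1 K),
    ← wordExp_init hp0 hp1 (n := n) (g := fun w =>
      if (strictLTRMaxSet w).card = s + 1 ∧ K < Finset.univ.sup w then (1 : ℝ) else 0)
      fun w => abs_indicator_le_one _,
    ← wordExp_add hp0 hp1 (fun w => abs_indicator_le_one _) hb]
  refine wordExp_mono hp0 hp1 (B' := 2) (fun w => abs_indicator_le_one _) (fun w => ?_)
    fun w hw => ?_
  · exact (abs_add_le _ _).trans ((add_le_add (abs_indicator_le_one _) (hb w)).trans (by norm_num))
  · rw [card_strictLTRMaxSet_succ_of_pos hw, sup_word_succ]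
    by_cases h : Finset.univ.sup (Fin.init w) < w (Fin.last n)
    · rw [if_pos h, max_eq_right h.le, ite_zero_mul_ite_zero, mul_one]
      simp only [add_left_inj]
      refine le_add_of_nonneg_left ?_
      split_ifs <;> simp
    · rw [if_neg h, max_eq_left (not_lt.1 h), add_zero]
      refine le_add_of_nonneg_right ?_
      split_ifs <;> simp

lemma wordExp_card_lt (hp0 : 0 < p) (hp1 : p < 1) (n r : ℕ) :
    wordExp p n (fun w => if (strictLTRMaxSet w).card < r then 1 else 0) =
      ∑ s ∈ Finset.range r, recordProb p n s := by
  unfold recordProb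
  rw [← wordExp_sum hp0 hp1 _ fun i w => abs_indicator_le_one _]
  congr 1
  funext w
  simp

lemma wordExp_le_card (hp0 : 0 < p) (hp1 : p < 1) (n r : ℕ) :
    wordExp p n (fun w => if r ≤ (strictLTRMaxSet w).card then 1 else 0) =
      1 - ∑ s ∈ Finset.range r, recordProb p n s := by
  rw [← wordExp_card_lt hp0 hp1, eq_sub_iff_add_eq,
    ← wordExp_add hp0 hp1 (fun w => abs_indicator_le_one _) (fun w => abs_indicator_le_one _)]
  refine (wordExp_congr fun w _ => ?_).trans (wordExp_one hp0 hp1 n)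
  by_cases h : r ≤ (strictLTRMaxSet w).card
  · simp [h, not_lt.2 h]
  · simp [h, not_le.1 h]

lemma wordExp_truncPos (hp0 : 0 < p) (hp1 : p < 1) {r : ℕ} (hr : 1 ≤ r) (n : ℕ) :
    wordExp p n (truncPos r) =
      ∑ s ∈ Finset.range r, ∑ j ∈ Finset.range n, recordProb p j s -
        n * ∑ s ∈ Finset.range r, recordProb p n s := by
  rw [Finset.sum_comm]
  simp only [← wordExp_card_lt hp0 hp1]
  induction n with
  | zero =>
    rw [wordExp_zero]
    simp [truncPos, strictLTRMaxSet, show r ≠ 0 by omega]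
  | succ n ih =>
    obtain ⟨B, hB⟩ := truncPos_bounded hr n
    have h1 : wordExp p (n + 1) (truncPos r) = wordExp p (n + 1) (fun w =>
        (truncPos r (Fin.init w) + (n + 1 : ℝ) *
          (if (strictLTRMaxSet (Fin.init w)).card < r then 1 else 0)) +
        (-(n + 1 : ℝ)) * (if (strictLTRMaxSet w).card < r then 1 else 0)) := by
      congr 1
      funext w
      rw [truncPos_succ hr]
      ring
    have hi : ∀ (c : ℝ) (P : Prop) [Decidable P], |c * (if P then 1 else 0)| ≤ |c| := by
      intro c P _
      rw [abs_mul]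
      exact mul_le_of_le_one_right (abs_nonneg _) (abs_indicator_le_one _)
    rw [h1, wordExp_add hp0 hp1 (B := B + |(n + 1 : ℝ)|)
        (fun w => (abs_add_le _ _).trans (add_le_add (hB _) (hi _ _))) (fun w => hi _ _),
      wordExp_add hp0 hp1 (fun w => hB _) (fun w => hi _ _), wordExp_init hp0 hp1 hB, ih,
      wordExp_const_mul, wordExp_const_mul, Finset.sum_range_succ,
      wordExp_init hp0 hp1 (g := fun w => if (strictLTRMaxSet w).card < r then (1 : ℝ) else 0)
        fun w => abs_indicator_le_one _]
    push_cast
    ring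

end Recursion

/-- The truncated generating function `∑ n < N, z ^ n * recordMaxProb p n s k`. -/
noncomputable def recordMaxSum (p z : ℝ) (s N k : ℕ) : ℝ :=
  ∑ n ∈ Finset.range N, z ^ n * recordMaxProb p n s k

section Bounds

variable {p : ℝ}

lemma recordMaxProb_succ_right_zero (hp0 : 0 < p) (hp1 : p < 1) (n s : ℕ) :
    recordMaxProb p n (s + 1) 0 = 0 := by
  rcases n with _ | n
  · simp [recordMaxProb_zero_left]
  · simp [recordMaxProb_succ_succ hp0 hp1]

lemma recordMaxSum_nonneg (hp0 : 0 < p) (hp1 : p < 1) {z : ℝ} (hz : 0 ≤ z) (s N k : ℕ) :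
    0 ≤ recordMaxSum p z s N k :=
  Finset.sum_nonneg fun n _ => mul_nonneg (pow_nonneg hz n) (recordMaxProb_nonneg hp0 hp1 n s k)

lemma recordMaxSum_zero (z : ℝ) (N k : ℕ) :
    recordMaxSum p z 0 (N + 1) k = if k = 0 then 1 else 0 := by
  unfold recordMaxSum
  rw [Finset.sum_range_succ']
  simp [recordMaxProb_succ_zero, recordMaxProb_zero_left]

lemma recordMaxSum_succ (hp0 : 0 < p) (hp1 : p < 1) (z : ℝ) (s N k : ℕ) :
    recordMaxSum p z (s + 1) (N + 1) k =
      z * (1 - (1 - p) ^ k) * recordMaxSum p z (s + 1) N k +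
        z * (p / (1 - p) * (1 - p) ^ k) * ∑ j ∈ Finset.range k, recordMaxSum p z s N j := by
  unfold recordMaxSum
  rw [Finset.sum_range_succ', Finset.sum_comm, Finset.mul_sum, Finset.mul_sum,
    ← Finset.sum_add_distrib, recordMaxProb_zero_left]
  simp only [Nat.add_eq_zero_iff, one_ne_zero, and_false, false_and, if_false, mul_zero, add_zero]
  refine Finset.sum_congr rfl fun n _ => ?_
  rw [recordMaxProb_succ_succ hp0 hp1, ← Finset.mul_sum]
  ring

lemma sum_recordMaxSum_le (hp0 : 0 < p) (hp1 : p < 1) {z : ℝ} (hz1 : 1 ≤ z) (hz2 : z ≤ 2) {k : ℕ}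
    (hz : z * (1 - (1 - p) ^ k) ≤ 1 - (1 - p) ^ k / 4) (s N : ℕ) {i : ℕ} (hi : i ≤ k) :
    ∑ j ∈ Finset.range i, recordMaxSum p z s N j ≤ (8 * (p / (1 - p)) * i) ^ s := by
  have hq : 0 < 1 - p := by linarith
  have hc : 0 < p / (1 - p) := by positivity
  have hzj : ∀ j ≤ k, z * (1 - (1 - p) ^ j) ≤ 1 - (1 - p) ^ j / 4 := fun j hj => by
    have := pow_le_pow_of_le_one hq.le (by linarith : 1 - p ≤ 1) hj
    nlinarith
  induction s generalizing N i with
  | zero =>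
    rcases N with _ | N
    · simp [recordMaxSum]
    · simp only [recordMaxSum_zero, pow_zero, Finset.sum_ite_eq']
      split_ifs <;> norm_num
  | succ s ih =>
    have key : ∀ j ≤ k, recordMaxSum p z (s + 1) N j ≤
        8 * (p / (1 - p)) * (8 * (p / (1 - p)) * j) ^ s := fun j hj => by
      induction N with
      | zero =>
        simp only [recordMaxSum, Finset.range_zero, Finset.sum_empty]
        positivity
      | succ N ihN =>
        rw [recordMaxSum_succ hp0 hp1]
        set Y := (8 * (p / (1 - p)) * j : ℝ) ^ s
        have hY : 0 ≤ Y := by positivity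
        have hx : 0 < (1 - p) ^ j := by positivity
        have hx1 : (1 - p) ^ j ≤ 1 := pow_le_one₀ hq.le (by linarith)
        have h1 : z * (1 - (1 - p) ^ j) * recordMaxSum p z (s + 1) N j ≤
            (1 - (1 - p) ^ j / 4) * (8 * (p / (1 - p)) * Y) :=
          mul_le_mul (hzj j hj) ihN
            (recordMaxSum_nonneg hp0 hp1 (by linarith) _ _ _) (by linarith)
        have h2 : z * (p / (1 - p) * (1 - p) ^ j) *
            ∑ l ∈ Finset.range j, recordMaxSum p z s N l ≤
              2 * (p / (1 - p) * (1 - p) ^ j) * Y :=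
          mul_le_mul (mul_le_mul_of_nonneg_right hz2 (by positivity)) (ih N hj)
            (Finset.sum_nonneg fun l _ => recordMaxSum_nonneg hp0 hp1 (by linarith) _ _ _)
            (by positivity)
        linarith
    calc ∑ j ∈ Finset.range i, recordMaxSum p z (s + 1) N j
        ≤ ∑ _j ∈ Finset.range i, 8 * (p / (1 - p)) * (8 * (p / (1 - p)) * i) ^ s := by
          refine Finset.sum_le_sum fun j hj => ?_
          have hji : j < i := Finset.mem_range.1 hj
          refine (key j (hji.le.trans hi)).trans ?_
          gcongr
      _ = (8 * (p / (1 - p)) * i) ^ (s + 1) := by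
          rw [Finset.sum_const, Finset.card_range, nsmul_eq_mul]
          ring

lemma pow_mul_recordMaxProb_le (hp0 : 0 < p) (hp1 : p < 1) {z : ℝ} (hz1 : 1 ≤ z) (hz2 : z ≤ 2)
    {k : ℕ} (hz : z * (1 - (1 - p) ^ k) ≤ 1 - (1 - p) ^ k / 4) (n s : ℕ) :
    z ^ n * recordMaxProb p n (s + 1) k ≤
      2 * (p / (1 - p) * (1 - p) ^ k) * ∑ j ∈ Finset.range k, recordMaxSum p z s n j := by
  have hq : 0 < 1 - p := by linarith
  induction n with
  | zero => simp [recordMaxProb_zero_left, recordMaxSum]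
  | succ n ih =>
    rw [recordMaxProb_succ_succ hp0 hp1]
    have hsum : ∑ j ∈ Finset.range k, recordMaxSum p z s (n + 1) j =
        ∑ j ∈ Finset.range k, recordMaxSum p z s n j +
          z ^ n * ∑ j ∈ Finset.range k, recordMaxProb p n s j := by
      rw [Finset.mul_sum, ← Finset.sum_add_distrib]
      exact Finset.sum_congr rfl fun j _ => by rw [recordMaxSum, Finset.sum_range_succ]; rfl
    rw [hsum]
    have hx : 0 < (1 - p) ^ k := by positivity
    have h1 : z * (1 - (1 - p) ^ k) * (z ^ n * recordMaxProb p n (s + 1) k) ≤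
        z ^ n * recordMaxProb p n (s + 1) k :=
      mul_le_of_le_one_left (mul_nonneg (by positivity) (recordMaxProb_nonneg hp0 hp1 _ _ _))
        (by linarith)
    have h2 : z * ((p / (1 - p) * (1 - p) ^ k) *
          (z ^ n * ∑ j ∈ Finset.range k, recordMaxProb p n s j)) ≤
        2 * ((p / (1 - p) * (1 - p) ^ k) *
          (z ^ n * ∑ j ∈ Finset.range k, recordMaxProb p n s j)) := by
      refine mul_le_mul_of_nonneg_right hz2 (mul_nonneg (by positivity) (mul_nonneg (by positivity) ?_))
      exact Finset.sum_nonneg fun j _ => recordMaxProb_nonneg hp0 hp1 _ _ _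
    rw [pow_succ]
    linarith

lemma tilted_pow_mul_recordMaxProb_le (hp0 : 0 < p) (hp1 : p < 1) (n s k : ℕ) :
    ((1 + (1 - p) ^ k / 4) ^ n) ^ 2 * recordMaxProb p n (s + 1) k ≤
      2 * (p / (1 - p) * (1 - p) ^ k) * (8 * (p / (1 - p)) * k) ^ s := by
  have hq : 0 < 1 - p := by linarith
  have hx : 0 < (1 - p) ^ k := by positivity
  have hx1 : (1 - p) ^ k ≤ 1 := pow_le_one₀ hq.le (by linarith)
  rw [← pow_mul, mul_comm n 2, pow_mul]
  have hz1 : 1 ≤ (1 + (1 - p) ^ k / 4) ^ 2 := one_le_pow₀ (by linarith)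
  have hz2 : (1 + (1 - p) ^ k / 4) ^ 2 ≤ 2 := by nlinarith
  have hz : (1 + (1 - p) ^ k / 4) ^ 2 * (1 - (1 - p) ^ k) ≤ 1 - (1 - p) ^ k / 4 := by
    set x := (1 - p) ^ k
    nlinarith [mul_nonneg hx.le (sub_nonneg.2 hx1), mul_pos hx hx, pow_pos hx 3]
  refine (pow_mul_recordMaxProb_le hp0 hp1 hz1 hz2 hz n s).trans ?_
  exact mul_le_mul_of_nonneg_left (sum_recordMaxSum_le hp0 hp1 hz1 hz2 hz s n le_rfl)
    (by positivity)

lemma mul_recordMaxProb_le (hp0 : 0 < p) (hp1 : p < 1) (n s k : ℕ) :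
    n * recordMaxProb p n (s + 1) k ≤ (8 * (p / (1 - p))) ^ (s + 1) * (k : ℝ) ^ s := by
  have hq : 0 < 1 - p := by linarith
  have hx : 0 < (1 - p) ^ k := by positivity
  have h := tilted_pow_mul_recordMaxProb_le hp0 hp1 n s k
  have hb : 1 + n * ((1 - p) ^ k / 4) ≤ (1 + (1 - p) ^ k / 4) ^ n :=
    one_add_mul_le_pow (by linarith) n
  have hny : 0 ≤ n * ((1 - p) ^ k / 4) := by positivity
  have hb2 : n * ((1 - p) ^ k / 4) ≤ ((1 + (1 - p) ^ k / 4) ^ n) ^ 2 := by nlinarith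
  have h2 := (mul_le_mul_of_nonneg_right hb2 (recordMaxProb_nonneg hp0 hp1 n (s + 1) k)).trans h
  have h3 : (1 - p) ^ k / 4 * (n * recordMaxProb p n (s + 1) k) ≤
      (1 - p) ^ k / 4 * ((8 * (p / (1 - p))) ^ (s + 1) * (k : ℝ) ^ s) := by
    calc _ = n * ((1 - p) ^ k / 4) * recordMaxProb p n (s + 1) k := by ring
      _ ≤ _ := h2
      _ = _ := by rw [mul_pow _ (k : ℝ), pow_succ]; ring
  exact le_of_mul_le_mul_left h3 (by positivity)

lemma sq_mul_recordMaxProb_le (hp0 : 0 < p) (hp1 : p < 1) (n s k : ℕ) :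
    (n : ℝ) ^ 2 * (1 - p) ^ k * recordMaxProb p n (s + 1) k ≤
      4 * (8 * (p / (1 - p))) ^ (s + 1) * (k : ℝ) ^ s := by
  have hq : 0 < 1 - p := by linarith
  have hx : 0 < (1 - p) ^ k := by positivity
  have h := tilted_pow_mul_recordMaxProb_le hp0 hp1 n s k
  have hb : 1 + n * ((1 - p) ^ k / 4) ≤ (1 + (1 - p) ^ k / 4) ^ n :=
    one_add_mul_le_pow (by linarith) n
  have hny : 0 ≤ n * ((1 - p) ^ k / 4) := by positivity
  have hb2 : (n * ((1 - p) ^ k / 4)) ^ 2 ≤ ((1 + (1 - p) ^ k / 4) ^ n) ^ 2 :=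
    pow_le_pow_left₀ hny (by linarith) 2
  have h2 := (mul_le_mul_of_nonneg_right hb2 (recordMaxProb_nonneg hp0 hp1 n (s + 1) k)).trans h
  have h3 : (1 - p) ^ k / 16 * ((n : ℝ) ^ 2 * (1 - p) ^ k * recordMaxProb p n (s + 1) k) ≤
      (1 - p) ^ k / 16 * (4 * (8 * (p / (1 - p))) ^ (s + 1) * (k : ℝ) ^ s) := by
    calc _ = (n * ((1 - p) ^ k / 4)) ^ 2 * recordMaxProb p n (s + 1) k := by ring
      _ ≤ _ := h2
      _ = _ := by rw [mul_pow _ (k : ℝ), pow_succ]; ring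
  exact le_of_mul_le_mul_left h3 (by positivity)

/-- The deficit of `∑ n < N, ∑ j ≤ k, recordMaxProb p n s j` from its limit as `N → ∞`. -/
noncomputable def recordDeficit (p : ℝ) (s N k : ℕ) : ℝ :=
  (p / (1 - p)) ^ s * k.choose s - ∑ j ∈ Finset.range (k + 1), recordMaxSum p 1 s N j

lemma recordDeficit_zero (N k : ℕ) : recordDeficit p 0 (N + 1) k = 0 := by
  simp [recordDeficit, recordMaxSum_zero]

lemma recordDeficit_succ_zero (hp0 : 0 < p) (hp1 : p < 1) (s N : ℕ) :
    recordDeficit p (s + 1) N 0 = 0 := by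
  simp [recordDeficit, recordMaxSum, recordMaxProb_succ_right_zero hp0 hp1]

lemma recordDeficit_succ_succ (hp0 : 0 < p) (hp1 : p < 1) (s N k : ℕ) :
    recordDeficit p (s + 1) N (k + 1) = recordDeficit p (s + 1) N k +
      p / (1 - p) * recordDeficit p s N k +
        recordMaxProb p N (s + 1) (k + 1) / (1 - p) ^ (k + 1) := by
  have hq : 0 < 1 - p := by linarith
  have hx : 0 < (1 - p) ^ (k + 1) := by positivity
  have h1 := recordMaxSum_succ hp0 hp1 1 s N (k + 1)
  have h2 : recordMaxSum p 1 (s + 1) (N + 1) (k + 1) = recordMaxSum p 1 (s + 1) N (k + 1) +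
      recordMaxProb p N (s + 1) (k + 1) := by
    simp [recordMaxSum, Finset.sum_range_succ]
  have h3 : recordMaxSum p 1 (s + 1) N (k + 1) =
      p / (1 - p) * ∑ j ∈ Finset.range (k + 1), recordMaxSum p 1 s N j -
        recordMaxProb p N (s + 1) (k + 1) / (1 - p) ^ (k + 1) := by
    rw [h2] at h1
    rw [eq_sub_iff_add_eq, ← mul_right_inj' hx.ne', mul_add, mul_div_cancel₀ _ hx.ne']
    linarith
  unfold recordDeficit
  rw [Finset.sum_range_succ _ (k + 1), h3, Nat.choose_succ_succ, pow_succ]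
  push_cast
  ring

lemma recordDeficit_nonneg (hp0 : 0 < p) (hp1 : p < 1) (s N k : ℕ) :
    0 ≤ recordDeficit p s (N + 1) k := by
  have hq : 0 < 1 - p := by linarith
  induction s generalizing k with
  | zero => rw [recordDeficit_zero]
  | succ s ih =>
    induction k with
    | zero => rw [recordDeficit_succ_zero hp0 hp1]
    | succ k ihk =>
      rw [recordDeficit_succ_succ hp0 hp1]
      have := recordMaxProb_nonneg hp0 hp1 (N + 1) (s + 1) (k + 1)
      have := ih k
      positivity

lemma exists_mul_recordDeficit_le (hp0 : 0 < p) (hp1 : p < 1) (s : ℕ) :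
    ∃ E : ℝ, 0 ≤ E ∧ ∀ N k : ℕ,
      (N + 1 : ℝ) * (1 - p) ^ k * recordDeficit p s (N + 1) k ≤ E * (k : ℝ) ^ (s - 1) := by
  have hq : 0 < 1 - p := by linarith
  induction s with
  | zero => exact ⟨0, le_rfl, fun N k => by rw [recordDeficit_zero]; simp⟩
  | succ s ih =>
    obtain ⟨E', hE', hs⟩ := ih
    set D := (8 * (p / (1 - p))) ^ (s + 1)
    have hD : 0 ≤ D := by positivity
    refine ⟨(p * E' + D) / p, by positivity, fun N k => ?_⟩
    set E := (p * E' + D) / p with hEdef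
    have hE : (1 - p) * E + p * E' + D = E := by
      rw [hEdef]; field_simp; ring
    have hE0 : 0 ≤ E := by positivity
    rw [Nat.add_sub_cancel]
    induction k with
    | zero =>
      rw [recordDeficit_succ_zero hp0 hp1, mul_zero]
      positivity
    | succ k ihk =>
      rw [recordDeficit_succ_succ hp0 hp1]
      have h1 : (k : ℝ) ^ s ≤ ((k + 1 : ℕ) : ℝ) ^ s := by gcongr; simp
      have h2 : (k : ℝ) ^ (s - 1) ≤ ((k + 1 : ℕ) : ℝ) ^ s := by
        calc (k : ℝ) ^ (s - 1) ≤ ((k + 1 : ℕ) : ℝ) ^ (s - 1) := by gcongr; simp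
          _ ≤ ((k + 1 : ℕ) : ℝ) ^ s := by
            gcongr
            · simp
            · exact Nat.sub_le s 1
      have h3 := mul_recordMaxProb_le hp0 hp1 (N + 1) s (k + 1)
      have hexp : (N + 1 : ℝ) * (1 - p) ^ (k + 1) * (recordDeficit p (s + 1) (N + 1) k +
          p / (1 - p) * recordDeficit p s (N + 1) k +
            recordMaxProb p (N + 1) (s + 1) (k + 1) / (1 - p) ^ (k + 1)) =
          (1 - p) * ((N + 1 : ℝ) * (1 - p) ^ k * recordDeficit p (s + 1) (N + 1) k) +
          p * ((N + 1 : ℝ) * (1 - p) ^ k * recordDeficit p s (N + 1) k) +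
          ((N + 1 : ℕ) : ℝ) * recordMaxProb p (N + 1) (s + 1) (k + 1) := by
        have hx : (1 - p) ^ k ≠ 0 := by positivity
        push_cast
        rw [pow_succ]
        field_simp
      rw [hexp, ← hE]
      have h4 := mul_le_mul_of_nonneg_left (ihk.trans (mul_le_mul_of_nonneg_left h1 hE0)) hq.le
      have h5 := mul_le_mul_of_nonneg_left ((hs N k).trans (mul_le_mul_of_nonneg_left h2 hE')) hp0.le
      rw [add_mul, add_mul]
      linarith

lemma recordTailProb_le (hp0 : 0 < p) (hp1 : p < 1) (n s K : ℕ) :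
    recordTailProb p n (s + 1) K ≤ (1 - p) ^ K * ∑ m ∈ Finset.range n, recordProb p m s := by
  induction n with
  | zero => simp [recordTailProb_zero_left]
  | succ n ih =>
    rw [Finset.sum_range_succ]
    have := recordTailProb_succ_le hp0 hp1 n s K
    linarith

lemma sum_recordProb_mono (hp0 : 0 < p) (hp1 : p < 1) (s : ℕ) :
    Monotone fun n => ∑ m ∈ Finset.range n, recordProb p m s := fun _ _ h =>
  Finset.sum_le_sum_of_subset_of_nonneg (Finset.range_mono h)
    fun _ _ _ => recordProb_nonneg hp0 hp1 _ _

lemma exists_abs_sum_recordProb_sub_le (hp0 : 0 < p) (hp1 : p < 1) (s : ℕ) :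
    ∃ E : ℝ, ∀ N K : ℕ, 1 ≤ N → 1 ≤ N * (1 - p) ^ K → N * (1 - p) ^ K ≤ 1 / (1 - p) →
      |∑ n ∈ Finset.range N, recordProb p n (s + 1) -
        (p / (1 - p)) ^ (s + 1) * K.choose (s + 1)| ≤
      E * (K : ℝ) ^ s + 1 / (1 - p) * ∑ n ∈ Finset.range N, recordProb p n s := by
  obtain ⟨E, hE, h⟩ := exists_mul_recordDeficit_le hp0 hp1 (s + 1)
  refine ⟨E, fun N K hN hK1 hK2 => ?_⟩
  have hS0 : 0 ≤ ∑ n ∈ Finset.range N, recordProb p n s :=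
    Finset.sum_nonneg fun _ _ => recordProb_nonneg hp0 hp1 _ _
  have hdef : recordDeficit p (s + 1) N K ≤ E * (K : ℝ) ^ s ∧ 0 ≤ recordDeficit p (s + 1) N K := by
    obtain ⟨N, rfl⟩ := Nat.exists_eq_add_of_le' hN
    have h0 := recordDeficit_nonneg hp0 hp1 (s + 1) N K
    refine ⟨?_, h0⟩
    have h1 := h N K
    push_cast at hK1
    exact (le_mul_of_one_le_left h0 hK1).trans h1
  set T := ∑ n ∈ Finset.range N, recordTailProb p n (s + 1) K
  have hT0 : 0 ≤ T := Finset.sum_nonneg fun _ _ => recordTailProb_nonneg hp0 hp1 _ _ _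
  have hT : T ≤ 1 / (1 - p) * ∑ n ∈ Finset.range N, recordProb p n s := by
    have hq : 0 < 1 - p := by linarith
    calc T ≤ ∑ _n ∈ Finset.range N, (1 - p) ^ K * ∑ m ∈ Finset.range N, recordProb p m s := by
          refine Finset.sum_le_sum fun n hn => (recordTailProb_le hp0 hp1 n s K).trans ?_
          exact mul_le_mul_of_nonneg_left
            (sum_recordProb_mono hp0 hp1 s (Finset.mem_range.1 hn).le) (by positivity)
      _ = N * (1 - p) ^ K * ∑ m ∈ Finset.range N, recordProb p m s := by
          rw [Finset.sum_const, Finset.card_range, nsmul_eq_mul, mul_assoc]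
      _ ≤ _ := mul_le_mul_of_nonneg_right hK2 hS0
  have hsum : ∑ n ∈ Finset.range N, recordProb p n (s + 1) -
      (p / (1 - p)) ^ (s + 1) * K.choose (s + 1) = T - recordDeficit p (s + 1) N K := by
    simp only [recordProb_eq_sum_add_tail hp0 hp1 _ _ K, Finset.sum_add_distrib, recordDeficit,
      recordMaxSum, one_pow, one_mul]
    rw [Finset.sum_comm]
    ring
  rw [hsum, abs_le]
  have : 0 ≤ E * (K : ℝ) ^ s := by positivity
  constructor <;> linarith [hdef.1, hdef.2]

lemma sum_inv_pow_le (hp1 : p < 1) (K : ℕ) :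
    p * (1 - p) ^ K * ∑ k ∈ Finset.range (K + 1), ((1 - p) ^ k)⁻¹ ≤ 1 := by
  have hq : 0 < 1 - p := by linarith
  induction K with
  | zero => simpa using hp1.le
  | succ K ih =>
    have hx : (1 - p) ^ (K + 1) ≠ 0 := by positivity
    rw [Finset.sum_range_succ, mul_add, mul_assoc p _ (_⁻¹), mul_inv_cancel₀ hx, pow_succ]
    nlinarith

lemma exists_mul_recordProb_le (hp0 : 0 < p) (hp1 : p < 1) (s : ℕ) :
    ∃ E : ℝ, ∀ N K : ℕ, 1 ≤ N → 1 ≤ N * (1 - p) ^ K → N * (1 - p) ^ K ≤ 1 / (1 - p) →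
      N * recordProb p N (s + 1) ≤
      E * (K : ℝ) ^ s + 1 / (1 - p) * ∑ n ∈ Finset.range N, recordProb p n s := by
  have hq : 0 < 1 - p := by linarith
  set D := 4 * (8 * (p / (1 - p))) ^ (s + 1)
  have hD : 0 ≤ D := by positivity
  refine ⟨D / p, fun N K hN hK1 hK2 => ?_⟩
  have hN0 : (0 : ℝ) < N := by exact_mod_cast hN
  have hS0 : 0 ≤ ∑ n ∈ Finset.range N, recordProb p n s :=
    Finset.sum_nonneg fun _ _ => recordProb_nonneg hp0 hp1 _ _
  rw [recordProb_eq_sum_add_tail hp0 hp1 _ _ K, mul_add]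
  refine add_le_add ?_ ?_
  · rw [Finset.mul_sum]
    calc ∑ k ∈ Finset.range (K + 1), N * recordMaxProb p N (s + 1) k
        ≤ ∑ k ∈ Finset.range (K + 1), D * (K : ℝ) ^ s / N * ((1 - p) ^ k)⁻¹ := by
          refine Finset.sum_le_sum fun k hk => ?_
          have hkK : k ≤ K := Nat.lt_succ_iff.1 (Finset.mem_range.1 hk)
          have h := (sq_mul_recordMaxProb_le hp0 hp1 N s k).trans
            (mul_le_mul_of_nonneg_left (pow_le_pow_left₀ (by positivity)
              (by exact_mod_cast hkK : (k : ℝ) ≤ K) s) hD)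
          have hx : 0 < (1 - p) ^ k := by positivity
          rw [← div_eq_mul_inv, le_div_iff₀ hx, le_div_iff₀ hN0]
          linarith
      _ = D * (K : ℝ) ^ s / N * ∑ k ∈ Finset.range (K + 1), ((1 - p) ^ k)⁻¹ := by
          rw [Finset.mul_sum]
      _ ≤ D * (K : ℝ) ^ s / N * (N / p) := by
          refine mul_le_mul_of_nonneg_left ?_ (by positivity)
          rw [le_div_iff₀ hp0]
          have h := sum_inv_pow_le hp1 K
          set Z := ∑ k ∈ Finset.range (K + 1), ((1 - p) ^ k)⁻¹
          have hZ : 0 ≤ Z := Finset.sum_nonneg fun k _ => by positivity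
          calc Z * p ≤ (N * (1 - p) ^ K) * (Z * p) := le_mul_of_one_le_left (by positivity) hK1
            _ = N * (p * (1 - p) ^ K * Z) := by ring
            _ ≤ N := mul_le_of_le_one_right hN0.le h
      _ = D / p * (K : ℝ) ^ s := by field_simp
  · calc _ ≤ N * ((1 - p) ^ K * ∑ m ∈ Finset.range N, recordProb p m s) :=
          mul_le_mul_of_nonneg_left (recordTailProb_le hp0 hp1 N s K) hN0.le
      _ ≤ _ := by
          rw [← mul_assoc]
          exact mul_le_mul_of_nonneg_right hK2 hS0

end Bounds

section Asymptotics

open Asymptotics Filter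

/-- The scale `log_Q n` with `Q = 1 / (1 - p)`. -/
noncomputable def logScale (p : ℝ) (n : ℕ) : ℝ := Real.log n / Real.log ((1 - p)⁻¹)

lemma log_inv_one_sub_pos (hp0 : 0 < p) (hp1 : p < 1) : 0 < Real.log ((1 - p)⁻¹) :=
  Real.log_pos ((one_lt_inv₀ (by linarith)).2 (by linarith))

lemma logScale_nonneg (hp0 : 0 < p) (hp1 : p < 1) (n : ℕ) : 0 ≤ logScale p n :=
  div_nonneg (Real.log_natCast_nonneg n) (log_inv_one_sub_pos hp0 hp1).le

lemma tendsto_logScale (hp0 : 0 < p) (hp1 : p < 1) : Tendsto (logScale p) atTop atTop :=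
  (Real.tendsto_log_atTop.comp tendsto_natCast_atTop_atTop).atTop_div_const
    (log_inv_one_sub_pos hp0 hp1)

lemma mul_pow_floor_logScale (hp0 : 0 < p) (hp1 : p < 1) {n : ℕ} (hn : 1 ≤ n) :
    1 ≤ n * (1 - p) ^ ⌊logScale p n⌋₊ ∧ n * (1 - p) ^ ⌊logScale p n⌋₊ ≤ 1 / (1 - p) := by
  have hl := log_inv_one_sub_pos hp0 hp1
  have hq : 0 < 1 - p := by linarith
  set l := Real.log ((1 - p)⁻¹) with hl_def
  have hexp : Real.exp l = 1 / (1 - p) := by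
    rw [hl_def, Real.exp_log (inv_pos.2 hq), one_div]
  have hlog : Real.log n = logScale p n * l := (div_mul_cancel₀ _ hl.ne').symm
  have hpow : n * (1 - p) ^ ⌊logScale p n⌋₊ =
      Real.exp ((logScale p n - ⌊logScale p n⌋₊) * l) := by
    rw [sub_mul, ← hlog, Real.exp_sub, Real.exp_log (by exact_mod_cast hn), Real.exp_nat_mul,
      hexp, one_div, inv_pow, div_inv_eq_mul]
  have h1 := Nat.floor_le (logScale_nonneg hp0 hp1 n)
  have h2 := Nat.lt_floor_add_one (logScale p n)
  rw [hpow]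
  refine ⟨Real.one_le_exp (mul_nonneg (by linarith) hl.le), ?_⟩
  rw [← hexp, Real.exp_le_exp]
  nlinarith

lemma isBigO_logScale_pow (hp0 : 0 < p) (hp1 : p < 1) {a b : ℕ} (hab : a ≤ b) :
    (fun n => logScale p n ^ a) =O[atTop] fun n => logScale p n ^ b := by
  refine IsBigO.of_bound 1 ?_
  filter_upwards [(tendsto_logScale hp0 hp1).eventually_ge_atTop 1] with n hn
  rw [one_mul, Real.norm_of_nonneg (by positivity), Real.norm_of_nonneg (by positivity)]
  exact pow_le_pow_right₀ hn hab

lemma isBigO_floor_logScale_pow (hp0 : 0 < p) (hp1 : p < 1) (s : ℕ) :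
    (fun n => (⌊logScale p n⌋₊ : ℝ) ^ s) =O[atTop] fun n => logScale p n ^ s := by
  refine IsBigO.pow (IsBigO.of_bound 1 (Eventually.of_forall fun n => ?_)) s
  have h := logScale_nonneg hp0 hp1 n
  rw [one_mul, Real.norm_of_nonneg (by positivity), Real.norm_of_nonneg h]
  exact Nat.floor_le h

lemma isBigO_descFactorial_floor_sub (hp0 : 0 < p) (hp1 : p < 1) (s : ℕ) :
    (fun n => (⌊logScale p n⌋₊.descFactorial (s + 1) : ℝ) - logScale p n ^ (s + 1))
      =O[atTop] fun n => logScale p n ^ s := by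
  have hsub : ∀ t : ℕ, (fun n => ((⌊logScale p n⌋₊ - t : ℕ) : ℝ) - logScale p n)
      =O[atTop] fun _ => (1 : ℝ) := fun t => by
    refine IsBigO.of_bound (t + 1) (Eventually.of_forall fun n => ?_)
    have h1 := Nat.floor_le (logScale_nonneg hp0 hp1 n)
    have h2 := Nat.lt_floor_add_one (logScale p n)
    have h3 : (⌊logScale p n⌋₊ : ℝ) ≤ ((⌊logScale p n⌋₊ - t : ℕ) : ℝ) + t := by
      exact_mod_cast (by omega : ⌊logScale p n⌋₊ ≤ ⌊logScale p n⌋₊ - t + t)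
    have h4 : ((⌊logScale p n⌋₊ - t : ℕ) : ℝ) ≤ ⌊logScale p n⌋₊ := by
      exact_mod_cast Nat.sub_le _ _
    have h5 : (0 : ℝ) ≤ t := t.cast_nonneg
    rw [norm_one, mul_one, Real.norm_eq_abs, abs_le]
    constructor <;> linarith
  induction s with
  | zero => simpa using hsub 0
  | succ s ih =>
    have hdesc : (fun n => (⌊logScale p n⌋₊.descFactorial (s + 1) : ℝ))
        =O[atTop] fun n => logScale p n ^ (s + 1) := by
      refine IsBigO.trans (IsBigO.of_bound 1 (Eventually.of_forall fun n => ?_))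
        (isBigO_floor_logScale_pow hp0 hp1 (s + 1))
      rw [one_mul, Real.norm_of_nonneg (by positivity), Real.norm_of_nonneg (by positivity)]
      exact_mod_cast Nat.descFactorial_le_pow _ _
    have h1 := (hsub (s + 1)).mul hdesc
    have h2 := (isBigO_refl (logScale p) atTop).mul ih
    refine ((h1.congr_right fun n => one_mul _).add
      (h2.congr_right fun n => (pow_succ' _ _).symm)).congr_left fun n => ?_
    rw [Nat.descFactorial_succ _ (s + 1)]
    push_cast
    ring

/-- The leading term `(c log_Q n)^s / s!` with `c = p / (1 - p)`. -/
noncomputable def mainTerm (p : ℝ) (s n : ℕ) : ℝ :=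
  1 / (s.factorial : ℝ) * (p / (1 - p) * logScale p n) ^ s

lemma isBigO_mainTerm (s : ℕ) : mainTerm p s =O[atTop] fun n => logScale p n ^ s := by
  refine ((isBigO_refl (fun n => logScale p n ^ s) atTop).const_mul_left
    (1 / (s.factorial : ℝ) * (p / (1 - p)) ^ s)).congr_left fun n => ?_
  rw [mainTerm, mul_pow, mul_assoc]

lemma isBigO_choose_floor_sub (hp0 : 0 < p) (hp1 : p < 1) (s : ℕ) :
    (fun n => (p / (1 - p)) ^ (s + 1) * (⌊logScale p n⌋₊.choose (s + 1) : ℝ) -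
      mainTerm p (s + 1) n) =O[atTop] fun n => logScale p n ^ s := by
  refine ((isBigO_descFactorial_floor_sub hp0 hp1 s).const_mul_left
    (1 / ((s + 1).factorial : ℝ) * (p / (1 - p)) ^ (s + 1))).congr_left fun n => ?_
  rw [mainTerm, mul_pow, Nat.descFactorial_eq_factorial_mul_choose]
  have : ((s + 1).factorial : ℝ) ≠ 0 := by positivity
  push_cast
  field_simp

lemma sum_recordProb_zero {n : ℕ} (hn : 1 ≤ n) : ∑ j ∈ Finset.range n, recordProb p j 0 = 1 := by
  obtain ⟨n, rfl⟩ := Nat.exists_eq_add_of_le' hn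
  rw [Finset.sum_range_succ', recordProb_zero_zero,
    Finset.sum_eq_zero fun j _ => recordProb_succ_zero j, zero_add]

lemma isBigO_sum_recordProb_sub (hp0 : 0 < p) (hp1 : p < 1) (s : ℕ)
    (h : (fun n => ∑ j ∈ Finset.range n, recordProb p j s) =O[atTop] fun n => logScale p n ^ s) :
    (fun n => ∑ j ∈ Finset.range n, recordProb p j (s + 1) - mainTerm p (s + 1) n)
      =O[atTop] fun n => logScale p n ^ s := by
  obtain ⟨E, hE⟩ := exists_abs_sum_recordProb_sub_le hp0 hp1 s
  have h1 : (fun n => ∑ j ∈ Finset.range n, recordProb p j (s + 1) -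
      (p / (1 - p)) ^ (s + 1) * (⌊logScale p n⌋₊.choose (s + 1) : ℝ))
      =O[atTop] fun n => logScale p n ^ s := by
    refine IsBigO.trans (IsBigO.of_bound 1 ?_)
      (((isBigO_floor_logScale_pow hp0 hp1 s).const_mul_left E).add
        (h.const_mul_left (1 / (1 - p))))
    filter_upwards [eventually_ge_atTop 1] with n hn
    obtain ⟨ha, hb⟩ := mul_pow_floor_logScale hp0 hp1 hn
    rw [one_mul]
    exact (hE n _ hn ha hb).trans (le_abs_self _)
  exact (h1.add (isBigO_choose_floor_sub hp0 hp1 s)).congr_left fun n => by ring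

lemma isBigO_sum_recordProb (hp0 : 0 < p) (hp1 : p < 1) (s : ℕ) :
    (fun n => ∑ j ∈ Finset.range n, recordProb p j s) =O[atTop] fun n => logScale p n ^ s := by
  induction s with
  | zero =>
    refine IsBigO.of_bound 1 ?_
    filter_upwards [eventually_ge_atTop 1] with n hn
    simp [sum_recordProb_zero hn]
  | succ s ih =>
    refine (((isBigO_sum_recordProb_sub hp0 hp1 s ih).trans
      (isBigO_logScale_pow hp0 hp1 s.le_succ)).add (isBigO_mainTerm (s + 1))).congr_left
        fun n => sub_add_cancel _ _

lemma isBigO_mul_recordProb (hp0 : 0 < p) (hp1 : p < 1) (s : ℕ) :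
    (fun n : ℕ => n * recordProb p n (s + 1)) =O[atTop] fun n => logScale p n ^ s := by
  obtain ⟨E, hE⟩ := exists_mul_recordProb_le hp0 hp1 s
  refine IsBigO.trans (IsBigO.of_bound 1 ?_)
    (((isBigO_floor_logScale_pow hp0 hp1 s).const_mul_left E).add
      ((isBigO_sum_recordProb hp0 hp1 s).const_mul_left (1 / (1 - p))))
  filter_upwards [eventually_ge_atTop 1] with n hn
  obtain ⟨ha, hb⟩ := mul_pow_floor_logScale hp0 hp1 hn
  rw [one_mul, Real.norm_of_nonneg (mul_nonneg n.cast_nonneg (recordProb_nonneg hp0 hp1 n _))]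
  exact (hE n _ hn ha hb).trans (le_abs_self _)

lemma isBigO_mul_sum_recordProb (hp0 : 0 < p) (hp1 : p < 1) (s : ℕ) :
    (fun n : ℕ => n * ∑ i ∈ Finset.range (s + 2), recordProb p n i)
      =O[atTop] fun n => logScale p n ^ s := by
  simp_rw [Finset.mul_sum]
  refine IsBigO.fun_sum fun i hi => ?_
  rcases i with _ | i
  · refine IsBigO.of_bound 1 ?_
    filter_upwards [eventually_ge_atTop 1] with n hn
    obtain ⟨n, rfl⟩ := Nat.exists_eq_add_of_le' hn
    rw [recordProb_succ_zero, mul_zero, norm_zero]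
    positivity
  · exact (isBigO_mul_recordProb hp0 hp1 i).trans
      (isBigO_logScale_pow hp0 hp1 (by have := Finset.mem_range.1 hi; omega))

lemma isLittleO_logScale_pow (s : ℕ) :
    (fun n => logScale p n ^ s) =o[atTop] fun n : ℕ => (n : ℝ) := by
  have h : (fun x : ℝ => Real.log x ^ s) =o[atTop] fun x => x := Real.isLittleO_pow_log_id_atTop
  refine ((h.comp_tendsto tendsto_natCast_atTop_atTop).const_mul_left
    ((Real.log ((1 - p)⁻¹))⁻¹ ^ s)).congr_left fun n => ?_
  rw [logScale, div_eq_mul_inv, mul_pow, mul_comm]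
  rfl

lemma isBigO_wordExp_truncPos_sub (hp0 : 0 < p) (hp1 : p < 1) (s : ℕ) :
    (fun n => wordExp p n (truncPos (s + 2)) - mainTerm p (s + 1) n)
      =O[atTop] fun n => logScale p n ^ s := by
  have h1 : (fun n => ∑ i ∈ Finset.range (s + 1), ∑ j ∈ Finset.range n, recordProb p j i)
      =O[atTop] fun n => logScale p n ^ s :=
    IsBigO.fun_sum fun i hi => (isBigO_sum_recordProb hp0 hp1 i).trans
      (isBigO_logScale_pow hp0 hp1 (Nat.lt_succ_iff.1 (Finset.mem_range.1 hi)))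
  refine ((h1.add (isBigO_sum_recordProb_sub hp0 hp1 s (isBigO_sum_recordProb hp0 hp1 s))).sub
    (isBigO_mul_sum_recordProb hp0 hp1 s)).congr_left fun n => ?_
  rw [wordExp_truncPos hp0 hp1 (by omega),
    Finset.sum_range_succ (fun i => ∑ j ∈ Finset.range n, recordProb p j i) (s + 1)]
  ring

lemma isBigO_condExp_sub (hp0 : 0 < p) (hp1 : p < 1) (s : ℕ) :
    (fun n => wordExp p n (truncPos (s + 2)) /
        (1 - ∑ i ∈ Finset.range (s + 2), recordProb p n i) - mainTerm p (s + 1) n)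
      =O[atTop] fun n => logScale p n ^ s := by
  set G : ℕ → ℝ := fun n => ∑ i ∈ Finset.range (s + 2), recordProb p n i
  have hG : G =O[atTop] fun n : ℕ => logScale p n ^ s * (n : ℝ)⁻¹ := by
    refine ((isBigO_mul_sum_recordProb hp0 hp1 s).mul
      (isBigO_refl (fun n : ℕ => (n : ℝ)⁻¹) atTop)).congr' ?_ EventuallyEq.rfl
    filter_upwards [eventually_ge_atTop 1] with n hn
    have : (n : ℝ) ≠ 0 := by positivity
    simp only [G]
    field_simp
  have hlim : ∀ k, Tendsto (fun n : ℕ => logScale p n ^ k * (n : ℝ)⁻¹) atTop (nhds 0) := fun k =>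
    (isLittleO_logScale_pow k).tendsto_div_nhds_zero
  have hden : Tendsto (fun n => (1 - G n)⁻¹) atTop (nhds 1) := by
    simpa using ((hG.trans_tendsto (hlim s)).const_sub 1).inv₀ (by simp)
  have hcross : (fun n => mainTerm p (s + 1) n * G n) =O[atTop] fun n => logScale p n ^ s := by
    refine ((isBigO_mainTerm (s + 1)).mul hG).trans ?_
    refine ((isBigO_refl (fun n => logScale p n ^ s) atTop).mul
      ((hlim (s + 1)).isBigO_one ℝ)).congr (fun n => by ring) fun n => mul_one _
  refine (((isBigO_wordExp_truncPos_sub hp0 hp1 s).add hcross).mul (hden.isBigO_one ℝ)).congr'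
    ?_ (Eventually.of_forall fun n => mul_one _)
  filter_upwards [hden.eventually_ne one_ne_zero] with n hn
  have : 1 - G n ≠ 0 := fun h => hn (by rw [h, inv_zero])
  change _ = _ / (1 - G n) - _
  field_simp
  ring

end Asymptotics

lemma tsum_ite_wordWt (hp0 : 0 < p) (hp1 : p < 1) (r n : ℕ) :
    ∑' w : Fin n → ℕ, (if r ≤ (strictLTRMaxSet w).card then wordWt p w else 0) =
      1 - ∑ s ∈ Finset.range r, recordProb p n s := by
  rw [← wordExp_le_card hp0 hp1]
  exact tsum_congr fun w => by rw [ite_mul, one_mul, zero_mul]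

/-- **Theorem 2 of the paper.**  The average position of the `r`-th strict left-to-right
maximum — the conditional expectation of `τ_r` given that the word of length `n`
(i.i.d. geometric(p) letters) has at least `r` strict left-to-right maxima — equals
`(1/(r−1)!) ((p/q) log_Q n)^{r−1} + O((log n)^{r−2})` as `n → ∞`, where `q = 1 − p`,
`Q = 1/q` and `log_Q n = (log n)/(log Q)`. -/
theorem average_position_rth_strict_maximum (r : ℕ) (hr : 1 ≤ r)
    (p : ℝ) (hp0 : 0 < p) (hp1 : p < 1) :
    ∃ C > (0 : ℝ), ∃ N : ℕ, ∀ n ≥ N,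
      |(∑' w : Fin n → ℕ,
            (if r ≤ (strictLTRMaxSet w).card then (strictLTRMaxPos w r : ℝ) else 0) *
              wordWt p w) /
          (∑' w : Fin n → ℕ, if r ≤ (strictLTRMaxSet w).card then wordWt p w else 0) -
          (1 / ((r - 1).factorial : ℝ)) *
            ((p / (1 - p)) * (Real.log n / Real.log ((1 - p)⁻¹))) ^ (r - 1)| ≤
        C * (Real.log n) ^ (r - 2) := by
  simp_rw [tsum_ite_wordWt hp0 hp1]
  change ∃ C > (0 : ℝ), ∃ N : ℕ, ∀ n ≥ N, |wordExp p n (truncPos r) /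
    (1 - ∑ s ∈ Finset.range r, recordProb p n s) - mainTerm p (r - 1) n| ≤
      C * Real.log n ^ (r - 2)
  obtain rfl | ⟨s, rfl⟩ : r = 1 ∨ ∃ s, r = s + 2 := by
    rcases hr.eq_or_lt with h | h
    · exact Or.inl h.symm
    · exact Or.inr (Nat.exists_eq_add_of_le' h)
  · refine ⟨1, one_pos, 1, fun n hn => ?_⟩
    rw [wordExp_truncPos hp0 hp1 le_rfl, Finset.sum_range_one, Finset.sum_range_one,
      sum_recordProb_zero hn]
    obtain ⟨n, rfl⟩ := Nat.exists_eq_add_of_le' hn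
    simp [recordProb_succ_zero, mainTerm]
  · obtain ⟨C, hC, h⟩ := (isBigO_condExp_sub hp0 hp1 s).exists_pos
    obtain ⟨N, hN⟩ := Filter.eventually_atTop.1 h.bound
    have hl := log_inv_one_sub_pos hp0 hp1
    refine ⟨C / Real.log ((1 - p)⁻¹) ^ s, by positivity, N, fun n hn => (hN n hn).trans_eq ?_⟩
    rw [Real.norm_of_nonneg (pow_nonneg (logScale_nonneg hp0 hp1 n) s), logScale, div_pow,
      Nat.add_sub_cancel]
    ring
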